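/- Let K = (T, A) be an ALCHIO knowledge base, q a Boolean conjunctive query, V ⊆ T a subset of the TBox, and I an interpretation with I ⊭ q. Then there exist a polynomial p (with non-negative coefficients, depending only on T and q and not on A) and an interpretation J such that: (1) J ⊭ q; (2) vio(A, J) = vio(A, I); (3) for every axiom τ ∈ V, vio(τ, J) ⊆ vio(τ, I); and (4) |Δ^J| ≤ p(|A| + |vio_V(I)|), where vio_V(I) = ⋃_{τ∈V} vio(τ, I). -/

import Mathlib

namespace DL

/-! ### Syntax -/

abbrev IndName := ℕ
abbrev CName := ℕ
abbrev RName := ℕ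

/-- Roles: role names and inverse roles. -/
inductive Role where
  | name : RName → Role
  | inv  : RName → Role
deriving DecidableEq

/-- `ALCHIO` concepts. -/
inductive Concept where
  | top  : Concept
  | bot  : Concept
  | atom : CName → Concept
  | nom  : IndName → Concept
  | neg  : Concept → Concept
  | conj : Concept → Concept → Concept
  | ex   : Role → Concept → Concept
deriving DecidableEq

/-- TBox axioms: concept inclusions and role inclusions. -/
inductive Axiom where
  | ci : Concept → Concept → Axiom
  | ri : Role → Role → Axiom
deriving DecidableEq

/-- ABox assertions. -/
inductive Assertion where
  | ca : CName → IndName → Assertion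
  | ra : RName → IndName → IndName → Assertion
deriving DecidableEq

/-! ### Interpretations -/

/-- A DL interpretation with domain a subset of a universe `U`.  Individual names are
interpreted via `indI` (under the standard names assumption, the individual names of the
ABox under consideration are interpreted "as themselves", i.e. injectively). -/
structure Interp (U : Type) where
  dom : Set U
  indI : IndName → U
  cI : CName → Set U
  rI : RName → Set (U × U)
  cI_sub : ∀ A, cI A ⊆ dom
  rI_sub : ∀ r p, p ∈ rI r → p.1 ∈ dom ∧ p.2 ∈ dom

variable {U : Type}

/-- Every individual name denotes an element of the domain. -/
def Interp.Proper (I : Interp U) : Prop := ∀ a, I.indI a ∈ I.dom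

def Role.interp (I : Interp U) : Role → Set (U × U)
  | Role.name r => I.rI r
  | Role.inv r  => {p | (p.2, p.1) ∈ I.rI r}

def Concept.interp (I : Interp U) : Concept → Set U
  | Concept.top => I.dom
  | Concept.bot => ∅
  | Concept.atom A => I.cI A
  | Concept.nom a => {I.indI a} ∩ I.dom
  | Concept.neg C => I.dom \ Concept.interp I C
  | Concept.conj C D => Concept.interp I C ∩ Concept.interp I D
  | Concept.ex r C => {d | ∃ e, (d, e) ∈ Role.interp I r ∧ e ∈ Concept.interp I C}

def Assertion.sat (I : Interp U) : Assertion → Prop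
  | Assertion.ca A a => I.indI a ∈ I.cI A
  | Assertion.ra r a b => (I.indI a, I.indI b) ∈ I.rI r

/-! ### Violations and cost -/

/-- Violations of a concept inclusion `C ⊑ D`. -/
def vioCI (I : Interp U) (C D : Concept) : Set U :=
  Concept.interp I C \ Concept.interp I D

/-- Violations of a role inclusion `r ⊑ s`. -/
def vioRI (I : Interp U) (r s : Role) : Set (U × U) :=
  Role.interp I r \ Role.interp I s

/-- The number of violations of an axiom. -/
noncomputable def Axiom.vioCount (I : Interp U) : Axiom → ℕ∞
  | Axiom.ci C D => (vioCI I C D).encard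
  | Axiom.ri r s => (vioRI I r s).encard

open Classical in
/-- The cost of an interpretation w.r.t. a weighted knowledge base `(T, A)` with weight
functions `wT` (on TBox axioms) and `wA` (on ABox assertions). -/
noncomputable def cost (T : Finset Axiom) (A : Finset Assertion)
    (wT : Axiom → ℕ∞) (wA : Assertion → ℕ∞) (I : Interp U) : ℕ∞ :=
  (∑ τ ∈ T, wT τ * Axiom.vioCount I τ) +
    ∑ α ∈ A, (if Assertion.sat I α then 0 else wA α)

/-! ### Queries -/

inductive Term where
  | var : ℕ → Term
  | ind : IndName → Term
deriving DecidableEq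

inductive QAtom where
  | ca : CName → Term → QAtom
  | ra : RName → Term → Term → QAtom
deriving DecidableEq

/-- A Boolean conjunctive query: a finite set of atoms, all of whose variables are
(implicitly) existentially quantified. -/
abbrev BCQ := Finset QAtom

def Term.eval (I : Interp U) (π : ℕ → U) : Term → U
  | Term.var v => π v
  | Term.ind a => I.indI a

def QAtom.sat (I : Interp U) (π : ℕ → U) : QAtom → Prop
  | QAtom.ca A t => Term.eval I π t ∈ I.cI A
  | QAtom.ra r t t' => (Term.eval I π t, Term.eval I π t') ∈ I.rI r

/-- Satisfaction of a BCQ in an interpretation. -/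
def satQ (I : Interp U) (q : BCQ) : Prop :=
  ∃ π : ℕ → U, (∀ v, π v ∈ I.dom) ∧ ∀ a ∈ q, QAtom.sat I π a

/-- An instance query is a BCQ with a single atom. -/
def IsIQ (q : BCQ) : Prop := ∃ a : QAtom, q = {a}

/-! ### Cost-based semantics -/

/-- `k`-satisfiability: some interpretation has cost at most `k`. -/
def ksat (T : Finset Axiom) (A : Finset Assertion)
    (wT : Axiom → ℕ∞) (wA : Assertion → ℕ∞) (k : ℕ) : Prop :=
  ∃ (U : Type) (I : Interp U), I.Proper ∧ cost T A wT wA I ≤ (k : ℕ∞)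

/-- `K ⊨ₚᵏ q`: some interpretation of cost at most `k` satisfies `q`. -/
def satP (T : Finset Axiom) (A : Finset Assertion)
    (wT : Axiom → ℕ∞) (wA : Assertion → ℕ∞) (k : ℕ) (q : BCQ) : Prop :=
  ∃ (U : Type) (I : Interp U), I.Proper ∧ cost T A wT wA I ≤ (k : ℕ∞) ∧ satQ I q

/-- `K ⊨꜀ᵏ q`: every interpretation of cost at most `k` satisfies `q`. -/
def satC (T : Finset Axiom) (A : Finset Assertion)
    (wT : Axiom → ℕ∞) (wA : Assertion → ℕ∞) (k : ℕ) (q : BCQ) : Prop :=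
  ∀ (U : Type) (I : Interp U), I.Proper → cost T A wT wA I ≤ (k : ℕ∞) → satQ I q

/-- The optimal cost of a weighted knowledge base. -/
noncomputable def optCost (T : Finset Axiom) (A : Finset Assertion)
    (wT : Axiom → ℕ∞) (wA : Assertion → ℕ∞) : ℕ∞ :=
  sInf {c : ℕ∞ | ∃ (U : Type) (I : Interp U), I.Proper ∧ cost T A wT wA I = c}

/-- `K ⊨ₚᵒᵖᵗ q`: some interpretation of optimal cost satisfies `q`. -/
noncomputable def satPopt (T : Finset Axiom) (A : Finset Assertion)
    (wT : Axiom → ℕ∞) (wA : Assertion → ℕ∞) (q : BCQ) : Prop :=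
  ∃ (U : Type) (I : Interp U), I.Proper ∧ cost T A wT wA I = optCost T A wT wA ∧ satQ I q

/-- `K ⊨꜀ᵒᵖᵗ q`: every interpretation of optimal cost satisfies `q`. -/
noncomputable def satCopt (T : Finset Axiom) (A : Finset Assertion)
    (wT : Axiom → ℕ∞) (wA : Assertion → ℕ∞) (q : BCQ) : Prop :=
  ∀ (U : Type) (I : Interp U), I.Proper → cost T A wT wA I = optCost T A wT wA → satQ I q

/-! ### Occurrences of symbols -/

def Role.base : Role → RName
  | Role.name r => r
  | Role.inv r => r

def Concept.cnames : Concept → Finset CName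
  | Concept.atom A => {A}
  | Concept.neg C => C.cnames
  | Concept.conj C D => C.cnames ∪ D.cnames
  | Concept.ex _ C => C.cnames
  | _ => ∅

def Concept.rnames : Concept → Finset RName
  | Concept.neg C => C.rnames
  | Concept.conj C D => C.rnames ∪ D.rnames
  | Concept.ex r C => insert r.base C.rnames
  | _ => ∅

def Concept.indNames : Concept → Finset IndName
  | Concept.nom a => {a}
  | Concept.neg C => C.indNames
  | Concept.conj C D => C.indNames ∪ D.indNames
  | Concept.ex _ C => C.indNames
  | _ => ∅

def Axiom.cnames : Axiom → Finset CName
  | Axiom.ci C D => C.cnames ∪ D.cnames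
  | Axiom.ri _ _ => ∅

def Axiom.rnames : Axiom → Finset RName
  | Axiom.ci C D => C.rnames ∪ D.rnames
  | Axiom.ri r s => {r.base, s.base}

def Axiom.indNames : Axiom → Finset IndName
  | Axiom.ci C D => C.indNames ∪ D.indNames
  | Axiom.ri _ _ => ∅

def Assertion.cnames : Assertion → Finset CName
  | Assertion.ca A _ => {A}
  | Assertion.ra _ _ _ => ∅

def Assertion.rnames : Assertion → Finset RName
  | Assertion.ca _ _ => ∅
  | Assertion.ra r _ _ => {r}

def Assertion.indNames : Assertion → Finset IndName
  | Assertion.ca _ a => {a}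
  | Assertion.ra _ a b => {a, b}

/-- The individual names occurring in an ABox. -/
def aboxInds (A : Finset Assertion) : Finset IndName := A.biUnion Assertion.indNames

/-- The individual names occurring in a KB. -/
def kbInds (T : Finset Axiom) (A : Finset Assertion) : Finset IndName :=
  T.biUnion Axiom.indNames ∪ aboxInds A

def Term.indNames : Term → Finset IndName
  | Term.var _ => ∅
  | Term.ind a => {a}

def QAtom.indNames : QAtom → Finset IndName
  | QAtom.ca _ t => t.indNames
  | QAtom.ra _ t t' => t.indNames ∪ t'.indNames

def QAtom.cnames : QAtom → Finset CName
  | QAtom.ca A _ => {A}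
  | QAtom.ra _ _ _ => ∅

def qInds (q : BCQ) : Finset IndName := q.biUnion QAtom.indNames

def qCnames (q : BCQ) : Finset CName := q.biUnion QAtom.cnames

/-! ### Sizes -/

def Concept.size : Concept → ℕ
  | Concept.top => 1
  | Concept.bot => 1
  | Concept.atom _ => 1
  | Concept.nom _ => 1
  | Concept.neg C => C.size + 1
  | Concept.conj C D => C.size + D.size + 1
  | Concept.ex _ C => C.size + 2

def Axiom.size : Axiom → ℕ
  | Axiom.ci C D => C.size + D.size + 1
  | Axiom.ri _ _ => 3

def Assertion.size : Assertion → ℕ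
  | Assertion.ca _ _ => 2
  | Assertion.ra _ _ _ => 3

def tboxSize (T : Finset Axiom) : ℕ := ∑ τ ∈ T, τ.size

def aboxSize (A : Finset Assertion) : ℕ := ∑ α ∈ A, α.size

/-! ### DL-Lite fragments -/

/-- Basic concepts: concept names and unqualified existential restrictions `∃r` (with a
possibly inverse role `r`), the latter rendered as `∃r.⊤`. -/
inductive IsBasic : Concept → Prop
  | atom (A : CName) : IsBasic (Concept.atom A)
  | ex (r : Role) : IsBasic (Concept.ex r Concept.top)

/-- A `DL-Lite_core` axiom: `B ⊑ C` or `B ⊓ C ⊑ ⊥` with `B, C` basic concepts. -/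
def IsCoreAxiom (τ : Axiom) : Prop :=
  (∃ B C, τ = Axiom.ci B C ∧ IsBasic B ∧ IsBasic C) ∨
  (∃ B C, τ = Axiom.ci (Concept.conj B C) Concept.bot ∧ IsBasic B ∧ IsBasic C)

def IsDLLiteCore (T : Finset Axiom) : Prop := ∀ τ ∈ T, IsCoreAxiom τ

/-- Concepts built from basic concepts using `¬`, `⊓` (and hence also `⊔`). -/
inductive IsBoolConcept : Concept → Prop
  | basic {C} : IsBasic C → IsBoolConcept C
  | neg {C} : IsBoolConcept C → IsBoolConcept (Concept.neg C)
  | conj {C D} : IsBoolConcept C → IsBoolConcept D → IsBoolConcept (Concept.conj C D)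

/-- A `DL-Lite_bool^H` axiom: a concept inclusion between Boolean combinations of basic
concepts, or a role inclusion. -/
def IsBoolHAxiom (τ : Axiom) : Prop :=
  (∃ C D, τ = Axiom.ci C D ∧ IsBoolConcept C ∧ IsBoolConcept D) ∨ (∃ r s, τ = Axiom.ri r s)

def IsDLLiteBoolH (T : Finset Axiom) : Prop := ∀ τ ∈ T, IsBoolHAxiom τ


/-- The violations of an axiom, gathered into a single set (elements for concept
inclusions, pairs for role inclusions). -/
def Axiom.vioSet (I : Interp U) : Axiom → Set (U ⊕ U × U)
  | Axiom.ci C D => Sum.inl '' vioCI I C D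
  | Axiom.ri r s => Sum.inr '' vioRI I r s

/-- `vio_V(I) = ⋃_{τ ∈ V} vio(τ, I)`. -/
def vioSetV (I : Interp U) (V : Finset Axiom) : Set (U ⊕ U × U) :=
  ⋃ τ ∈ V, Axiom.vioSet I τ

/-! ### The construction -/

section Construction

/-- Subconcepts. -/
def Concept.subs : Concept → Finset Concept
  | Concept.neg C => insert (Concept.neg C) C.subs
  | Concept.conj C D => insert (Concept.conj C D) (C.subs ∪ D.subs)
  | Concept.ex r C => insert (Concept.ex r C) C.subs
  | C => {C}

theorem Concept.self_mem_subs (C : Concept) : C ∈ C.subs := by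
  cases C <;> simp [Concept.subs]

variable (I : Interp U) (cl : Finset Concept) (RN : Finset RName) (K : Set I.dom)

open Classical in
noncomputable def wit (d : I.dom) (a : cl) : I.dom :=
  if h : ∃ e : I.dom, ∃ r C, a.1 = Concept.ex r C ∧ (d.1, e.1) ∈ Role.interp I r ∧
      e.1 ∈ Concept.interp I C then h.choose else d

theorem Concept.interp_sub (C : Concept) : Concept.interp I C ⊆ I.dom := by
  induction C with
  | top => exact fun x h => h
  | bot => exact fun x h => h.elim
  | atom A => exact I.cI_sub A
  | nom a => exact fun x h => h.2
  | neg C ih => exact fun x h => h.1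
  | conj C D ih1 ih2 => exact fun x h => ih1 h.1
  | ex r C ih =>
    rintro x ⟨e, h, _⟩
    cases r with
    | name r => exact (I.rI_sub r _ h).1
    | inv r => exact (I.rI_sub r _ h).2

theorem wit_spec (d : I.dom) (r : Role) (C : Concept) (h : Concept.ex r C ∈ cl)
    (hd : d.1 ∈ Concept.interp I (Concept.ex r C)) :
    (d.1, (wit I cl d ⟨_, h⟩).1) ∈ Role.interp I r ∧
      (wit I cl d ⟨_, h⟩).1 ∈ Concept.interp I C := by
  obtain ⟨e, h1, h2⟩ := hd
  have hex : ∃ e : I.dom, ∃ r' C', (⟨_, h⟩ : cl).1 = Concept.ex r' C' ∧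
      (d.1, e.1) ∈ Role.interp I r' ∧ e.1 ∈ Concept.interp I C' :=
    ⟨⟨e, Concept.interp_sub I C h2⟩, r, C, rfl, h1, h2⟩
  unfold wit
  rw [dif_pos hex]
  obtain ⟨r', C', h3, h4, h5⟩ := hex.choose_spec
  simp only [Concept.ex.injEq] at h3
  obtain ⟨rfl, rfl⟩ := h3
  exact ⟨h4, h5⟩

noncomputable def run (d : I.dom) : List cl → I.dom
  | [] => d
  | a :: u => wit I cl (run d u) a

theorem run_append (d : I.dom) (u w : List cl) :
    run I cl d (u ++ w) = run I cl (run I cl d w) u := by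
  induction u with
  | nil => rfl
  | cons a u ih => simp [run, ih]

abbrev Loc := (cl → Prop) × (cl → RN → Prop × Prop) × Option K

open Classical in
noncomputable def loc (d : I.dom) : Loc I cl RN K :=
  (fun C => d.1 ∈ Concept.interp I C.1,
   fun a r => ((d.1, (wit I cl d a).1) ∈ I.rI r.1, ((wit I cl d a).1, d.1) ∈ I.rI r.1),
   if h : d ∈ K then some ⟨d, h⟩ else none)

abbrev Wd (n : ℕ) := {l : List cl // l.length ≤ n}

abbrev TP (n : ℕ) := Wd cl n → Loc I cl RN K

noncomputable def tp (n : ℕ) (d : I.dom) : TP I cl RN K n :=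
  fun u => loc I cl RN K (run I cl d u.1)

abbrev Node := I.dom × List cl

noncomputable def walk (x : Node I cl) : I.dom := run I cl x.1 x.2

abbrev St (n : ℕ) := ZMod n × Wd cl n × (Fin (n+1) → TP I cl RN K n)

noncomputable def st (n : ℕ) (x : Node I cl) : St I cl RN K n :=
  ((x.2.length : ZMod n), ⟨x.2.take n, by simp⟩,
    fun i => tp I cl RN K n (run I cl x.1 (x.2.drop i)))

open Classical in
noncomputable def fm (code : Node I cl → ℕ) (x : Node I cl) : U ⊕ ℕ :=
  if walk I cl x ∈ K then Sum.inl (walk I cl x).1 else Sum.inr (code x)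

def adj (r : RName) (x y : Node I cl) : Prop :=
  (walk I cl x ∈ K ∧ walk I cl y ∈ K) ∨
    (r ∈ RN ∧ ((∃ a, y = (x.1, a :: x.2)) ∨ (∃ a, x = (y.1, a :: y.2))))

theorem adj_symm {r : RName} {x y : Node I cl} (h : adj I cl RN K r x y) :
    adj I cl RN K r y x := by
  unfold adj at *; tauto

open Classical in
noncomputable def mkJ (code : Node I cl → ℕ) (N : Finset IndName) : Interp (U ⊕ ℕ) where
  dom := Set.range (fm I cl K code)
  indI a := if a ∈ N then Sum.inl (I.indI a) else Sum.inl (I.indI 0)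
  cI A := {y | ∃ x, fm I cl K code x = y ∧ (walk I cl x).1 ∈ I.cI A ∧
    (walk I cl x ∈ K ∨ Concept.atom A ∈ cl)}
  rI r := {p | ∃ x y, fm I cl K code x = p.1 ∧ fm I cl K code y = p.2 ∧
    ((walk I cl x).1, (walk I cl y).1) ∈ I.rI r ∧ adj I cl RN K r x y}
  cI_sub := by rintro A _ ⟨x, rfl, _⟩; exact ⟨x, rfl⟩
  rI_sub := by
    rintro r ⟨p1, p2⟩ ⟨x, y, h1, h2, _⟩
    exact ⟨⟨x, h1⟩, ⟨y, h2⟩⟩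

variable (code : Node I cl → ℕ) (N : Finset IndName)

theorem role_mkJ (R : Role) (p : (U ⊕ ℕ) × (U ⊕ ℕ)) :
    p ∈ Role.interp (mkJ I cl RN K code N) R ↔
      ∃ x y, fm I cl K code x = p.1 ∧ fm I cl K code y = p.2 ∧
        ((walk I cl x).1, (walk I cl y).1) ∈ Role.interp I R ∧ adj I cl RN K R.base x y := by
  cases R with
  | name r => exact Iff.rfl
  | inv r =>
    constructor
    · rintro ⟨x, y, h1, h2, h3, h4⟩
      exact ⟨y, x, h2, h1, h3, adj_symm _ _ _ _ h4⟩
    · rintro ⟨x, y, h1, h2, h3, h4⟩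
      exact ⟨y, x, h2, h1, h3, adj_symm _ _ _ _ h4⟩

theorem fm_core {x : Node I cl} (h : walk I cl x ∈ K) :
    fm I cl K code x = Sum.inl (walk I cl x).1 := by simp [fm, h]

theorem fm_ncore {x : Node I cl} (h : walk I cl x ∉ K) :
    fm I cl K code x = Sum.inr (code x) := by simp [fm, h]

theorem fm_inl {x : Node I cl} {u : U} (h : fm I cl K code x = Sum.inl u) :
    walk I cl x ∈ K ∧ (walk I cl x).1 = u := by
  by_cases hx : walk I cl x ∈ K
  · rw [fm_core _ _ _ _ hx] at h
    exact ⟨hx, Sum.inl_injective h⟩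
  · rw [fm_ncore _ _ _ _ hx] at h
    cases h

theorem fm_eq {x y : Node I cl} (h : fm I cl K code x = fm I cl K code y) :
    (walk I cl x ∈ K ∧ walk I cl y ∈ K ∧ walk I cl x = walk I cl y) ∨
    (walk I cl x ∉ K ∧ walk I cl y ∉ K ∧ code x = code y) := by
  by_cases hx : walk I cl x ∈ K
  · rw [fm_core _ _ _ _ hx] at h
    obtain ⟨h1, h2⟩ := fm_inl _ _ _ _ h.symm
    exact Or.inl ⟨hx, h1, Subtype.ext h2.symm⟩
  · by_cases hy : walk I cl y ∈ K
    · rw [fm_core _ _ _ _ hy] at h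
      exact absurd (fm_inl _ _ _ _ h).1 hx
    · rw [fm_ncore _ _ _ _ hx, fm_ncore _ _ _ _ hy] at h
      exact Or.inr ⟨hx, hy, Sum.inr_injective h⟩

variable (n : ℕ)

/-- Equal codes of noncore nodes give equal states. -/
def GoodCode : Prop := ∀ x y : Node I cl, walk I cl x ∉ K → walk I cl y ∉ K → code x = code y →
  st I cl RN K n x = st I cl RN K n y

theorem fm_loc (hc : GoodCode I cl RN K code n) {x y : Node I cl} (h : fm I cl K code x = fm I cl K code y) :
    loc I cl RN K (walk I cl x) = loc I cl RN K (walk I cl y) := by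
  rcases fm_eq _ _ _ _ h with ⟨_, _, h⟩ | ⟨h1, h2, h3⟩
  · rw [h]
  · have := congrArg (fun s => s.2.2 0 ⟨[], by simp⟩) (hc x y h1 h2 h3)
    simpa [st, tp, run, walk] using this

theorem fm_mem (hc : GoodCode I cl RN K code n) {x y : Node I cl} (h : fm I cl K code x = fm I cl K code y)
    {C : Concept} (hC : C ∈ cl) :
    (walk I cl x).1 ∈ Concept.interp I C ↔ (walk I cl y).1 ∈ Concept.interp I C := by
  have := congrFun (congrArg (fun l => l.1) (fm_loc I cl RN K code n hc h)) ⟨C, hC⟩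
  simpa [loc] using this

theorem truth (hc : GoodCode I cl RN K code n) (hK : ∀ a ∈ N, ∀ h : I.indI a ∈ I.dom, (⟨_, h⟩ : I.dom) ∈ K)
    (C : Concept) (hC : C.subs ⊆ cl) (hR : C.rnames ⊆ RN)
    (hN : C.indNames ⊆ N) (x : Node I cl) :
    fm I cl K code x ∈ Concept.interp (mkJ I cl RN K code N) C ↔
      (walk I cl x).1 ∈ Concept.interp I C := by
  induction C generalizing x with
  | top => exact ⟨fun _ => (walk I cl x).2, fun _ => ⟨x, rfl⟩⟩
  | bot => exact Iff.rfl
  | atom A =>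
    have hA : Concept.atom A ∈ cl := hC (Concept.self_mem_subs _)
    constructor
    · rintro ⟨y, h1, h2, _⟩
      exact (fm_mem I cl RN K code n hc h1 hA).1 h2
    · intro h
      exact ⟨x, rfl, h, Or.inr hA⟩
  | nom a =>
    have ha : a ∈ N := hN (by simp [Concept.indNames])
    simp only [Concept.interp, mkJ, ha, if_true]
    constructor
    · rintro ⟨h, _⟩
      exact ⟨(fm_inl _ _ _ _ h).2, (walk I cl x).2⟩
    · rintro ⟨h, hd⟩
      have h' : (walk I cl x).1 = I.indI a := h
      have hk : walk I cl x ∈ K := by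
        have := hK a ha (h' ▸ hd)
        convert this using 1
        exact Subtype.ext h'
      refine ⟨?_, x, rfl⟩
      rw [fm_core _ _ _ _ hk, h']
      rfl
  | neg C ih =>
    have ih := ih (fun D hD => hC (by simp [Concept.subs, hD])) hR hN x
    constructor
    · rintro ⟨_, h⟩
      exact ⟨(walk I cl x).2, fun h' => h (ih.2 h')⟩
    · rintro ⟨_, h⟩
      exact ⟨⟨x, rfl⟩, fun h' => h (ih.1 h')⟩
  | conj C D ih1 ih2 =>
    have ih1 := ih1 (fun D hD => hC (by simp [Concept.subs, hD]))
      (fun D hD => hR (by simp [Concept.rnames, hD]))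
      (fun D hD => hN (by simp [Concept.indNames, hD])) x
    have ih2 := ih2 (fun D hD => hC (by simp [Concept.subs, hD]))
      (fun D hD => hR (by simp [Concept.rnames, hD]))
      (fun D hD => hN (by simp [Concept.indNames, hD])) x
    exact and_congr ih1 ih2
  | ex r C ih =>
    have ih := ih (fun D hD => hC (by simp [Concept.subs, hD]))
      (fun D hD => hR (by simp [Concept.rnames, hD])) hN
    have hex : Concept.ex r C ∈ cl := hC (Concept.self_mem_subs _)
    constructor
    · rintro ⟨e, h1, h2⟩
      obtain ⟨x', y', h3, h4, h5, _⟩ := (role_mkJ ..).1 h1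
      simp only at h3 h4
      subst h4
      exact (fm_mem I cl RN K code n hc h3 hex).1 ⟨_, h5, (ih y').1 h2⟩
    · intro h
      obtain ⟨h1, h2⟩ := wit_spec I cl _ r C hex h
      refine ⟨fm I cl K code (x.1, ⟨_, hex⟩ :: x.2), (role_mkJ ..).2 ⟨x, _, rfl, rfl, h1,
        Or.inr ⟨hR (by simp [Concept.rnames]), Or.inl ⟨_, rfl⟩⟩⟩, (ih _).2 h2⟩

noncomputable def ee [Nonempty I.dom] (j : ℕ) (x : Node I cl) : I.dom :=
  run I cl (Function.invFun (tp I cl RN K n) (tp I cl RN K n (run I cl x.1 (x.2.drop j))))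
    (x.2.take j)

theorem loc_ee [Nonempty I.dom] {j : ℕ} (hj : j ≤ n) (x : Node I cl) :
    loc I cl RN K (ee I cl RN K n j x) = loc I cl RN K (walk I cl x) := by
  have h := Function.invFun_eq (f := tp I cl RN K n)
    (b := tp I cl RN K n (run I cl x.1 (x.2.drop j))) ⟨_, rfl⟩
  have h2 := congrFun h ⟨x.2.take j, by simp; omega⟩
  unfold tp at h2
  simp only at h2
  rw [← run_append, List.take_append_drop] at h2
  exact h2

theorem core_of_loc {d e : I.dom} (h : loc I cl RN K d = loc I cl RN K e) (he : e ∈ K) :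
    d = e := by
  have := congrArg (fun l => l.2.2) h
  simp only [loc, he, dif_pos] at this
  split_ifs at this
  simpa using this

theorem ee_core [Nonempty I.dom] {j : ℕ} (hj : j ≤ n) {x : Node I cl} (hx : walk I cl x ∈ K) :
    ee I cl RN K n j x = walk I cl x :=
  core_of_loc I cl RN K (loc_ee I cl RN K n hj x) hx

theorem ee_succ [Nonempty I.dom] (j : ℕ) (x : Node I cl) (a : cl) :
    ee I cl RN K n (j+1) (x.1, a :: x.2) = wit I cl (ee I cl RN K n j x) a := by
  simp [ee, run]

open Classical in
noncomputable def GG [Nonempty I.dom] (ρ : ZMod n) (x : Node I cl) : I.dom :=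
  if walk I cl x ∈ K then walk I cl x else ee I cl RN K n ((x.2.length : ZMod n) - ρ).val x

theorem GG_congr [Nonempty I.dom] [NeZero n] (hc : GoodCode I cl RN K code n) (ρ : ZMod n) {x y : Node I cl}
    (h : fm I cl K code x = fm I cl K code y) :
    GG I cl RN K n ρ x = GG I cl RN K n ρ y := by
  rcases fm_eq _ _ _ _ h with ⟨h1, h2, h⟩ | ⟨h1, h2, h3⟩
  · simp [GG, h2, h]
  · have hs := hc x y h1 h2 h3
    have e1 : (x.2.length : ZMod n) = y.2.length := congrArg (fun s => s.1) hs
    have e2 : x.2.take n = y.2.take n := congrArg (fun s => s.2.1.1) hs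
    simp only [GG, h1, h2, if_false, e1]
    set j := ((y.2.length : ZMod n) - ρ).val with hj
    have hjn : j < n := ZMod.val_lt _
    have e3 := congrFun (congrArg (fun s => s.2.2) hs) ⟨j, by omega⟩
    simp only [st] at e3
    have e4 : x.2.take j = y.2.take j := by
      have := congrArg (List.take j) e2
      simpa [List.take_take, Nat.min_eq_left hjn.le] using this
    simp only [ee, e3, e4]

theorem GG_edge [Nonempty I.dom] [NeZero n] (ρ : ZMod n) (x : Node I cl) (a : cl)
    (hy : walk I cl (x.1, a :: x.2) ∈ K ∨ ((x.2.length + 1 : ℕ) : ZMod n) ≠ ρ) :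
    loc I cl RN K (GG I cl RN K n ρ x) = loc I cl RN K (walk I cl x) ∧
    GG I cl RN K n ρ (x.1, a :: x.2) = wit I cl (GG I cl RN K n ρ x) a := by
  suffices h : ∃ j, j + 1 ≤ n ∧ GG I cl RN K n ρ x = ee I cl RN K n j x ∧
      GG I cl RN K n ρ (x.1, a :: x.2) = ee I cl RN K n (j+1) (x.1, a :: x.2) by
    obtain ⟨j, hj, h1, h2⟩ := h
    rw [h1, h2]
    exact ⟨loc_ee _ _ _ _ _ (by omega) _, ee_succ ..⟩
  have hpos : 0 < n := NeZero.pos n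
  have key : ((x.2.length + 1 : ℕ) : ZMod n) ≠ ρ →
      (((x.2.length + 1 : ℕ) : ZMod n) - ρ).val = ((x.2.length : ZMod n) - ρ).val + 1 := by
    intro h
    set z := (x.2.length : ZMod n) - ρ with hz
    have e : ((x.2.length + 1 : ℕ) : ZMod n) - ρ = z + 1 := by
      rw [hz]; push_cast; ring
    rw [e]
    have hne : z + 1 ≠ 0 := by rw [← e]; exact sub_ne_zero.2 h
    by_contra hcon
    have hlt : z.val < n := ZMod.val_lt z
    have h1 : (z.val + 1) % n = (z + 1).val := by
      rw [← ZMod.val_natCast]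
      simp
    rcases Nat.lt_or_ge (z.val + 1) n with h2 | h2
    · rw [Nat.mod_eq_of_lt h2] at h1
      exact hcon h1.symm
    · have h3 : z.val + 1 = n := by omega
      rw [h3, Nat.mod_self] at h1
      exact hne ((ZMod.val_eq_zero _).1 h1.symm)
  by_cases cx : walk I cl x ∈ K
  · by_cases cy : walk I cl (x.1, a :: x.2) ∈ K
    · refine ⟨0, by omega, ?_, ?_⟩
      · rw [ee_core _ _ _ _ _ (by omega) cx]; simp [GG, cx]
      · rw [ee_core _ _ _ _ _ (by omega) cy]; simp [GG, cy]
    · have hy' := hy.resolve_left cy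
      have k := key hy'
      have hlt := ZMod.val_lt (((x.2.length + 1 : ℕ) : ZMod n) - ρ)
      refine ⟨((x.2.length : ZMod n) - ρ).val, by omega, ?_, ?_⟩
      · rw [ee_core _ _ _ _ _ (by omega) cx]; simp [GG, cx]
      · rw [← k]; simp [GG, cy]
  · have hlt := ZMod.val_lt ((x.2.length : ZMod n) - ρ)
    refine ⟨((x.2.length : ZMod n) - ρ).val, by omega, ?_, ?_⟩
    · simp [GG, cx]
    · by_cases cy : walk I cl (x.1, a :: x.2) ∈ K
      · rw [ee_core _ _ _ _ _ (by omega) cy]; simp [GG, cy]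
      · rw [← key (hy.resolve_left cy)]; simp [GG, cy]

theorem loc_GG [Nonempty I.dom] [NeZero n] (ρ : ZMod n) (x : Node I cl) :
    loc I cl RN K (GG I cl RN K n ρ x) = loc I cl RN K (walk I cl x) := by
  unfold GG
  split_ifs
  · rfl
  · exact loc_ee _ _ _ _ _ (ZMod.val_lt _).le _

theorem GG_core [Nonempty I.dom] (ρ : ZMod n) {x : Node I cl} (h : walk I cl x ∈ K) :
    GG I cl RN K n ρ x = walk I cl x := by simp [GG, h]

def Term.vars : Term → Finset ℕ
  | Term.var v => {v}
  | Term.ind _ => ∅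

def QAtom.vars : QAtom → Finset ℕ
  | QAtom.ca _ t => t.vars
  | QAtom.ra _ t t' => t.vars ∪ t'.vars

def qVars (q : BCQ) : Finset ℕ := q.biUnion QAtom.vars

def QAtom.rnames : QAtom → Finset RName
  | QAtom.ca _ _ => ∅
  | QAtom.ra r _ _ => {r}

theorem no_query [Nonempty I.dom] (q : BCQ) (hn : n = (qVars q).card + 1)
    (hc : GoodCode I cl RN K code n)
    (hK : ∀ a ∈ N, ∀ h : I.indI a ∈ I.dom, (⟨_, h⟩ : I.dom) ∈ K)
    (hqN : qInds q ⊆ N)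
    (hqc : ∀ A t, QAtom.ca A t ∈ q → Concept.atom A ∈ cl)
    (hqr : ∀ r t t', QAtom.ra r t t' ∈ q → r ∈ RN)
    (h : satQ (mkJ I cl RN K code N) q) : satQ I q := by
  obtain ⟨π, hπ, hq⟩ := h
  have : NeZero n := ⟨by omega⟩
  choose X hX using hπ
  obtain ⟨ρ, hρ⟩ : ∃ ρ : ZMod n, ρ ∉ (qVars q).image (fun v => ((X v).2.length : ZMod n)) := by
    by_contra hcon
    push Not at hcon
    have h1 : (Finset.univ : Finset (ZMod n)).card ≤ _ :=
      Finset.card_le_card (fun x _ => hcon x)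
    have h2 := Finset.card_image_le (s := qVars q) (f := fun v => ((X v).2.length : ZMod n))
    rw [Finset.card_univ, ZMod.card] at h1
    omega
  set π' : ℕ → U := fun v => (GG I cl RN K n ρ (X v)).1 with hπ'
  -- evaluation of terms
  have ev : ∀ t : Term, t.indNames ⊆ N → ∀ x : Node I cl,
      fm I cl K code x = Term.eval (mkJ I cl RN K code N) π t →
      Term.eval I π' t = (GG I cl RN K n ρ x).1 := by
    intro t ht x hx
    cases t with
    | var v =>
      simp only [Term.eval, hπ'] at hx ⊢
      rw [GG_congr I cl RN K code n hc ρ (hx.trans (hX v).symm)]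
    | ind a =>
      have ha : a ∈ N := ht (by simp [Term.indNames])
      simp only [Term.eval, mkJ, ha, if_true] at hx ⊢
      obtain ⟨h1, h2⟩ := fm_inl _ _ _ _ hx
      rw [GG_core _ _ _ _ _ _ h1, h2]
  have lev : ∀ t : Term, t.vars ⊆ qVars q → ∀ x : Node I cl,
      fm I cl K code x = Term.eval (mkJ I cl RN K code N) π t → t.indNames ⊆ N →
      walk I cl x ∈ K ∨ (x.2.length : ZMod n) ≠ ρ := by
    intro t ht x hx htN
    cases t with
    | var v =>
      have hv : v ∈ qVars q := ht (by simp [Term.vars])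
      simp only [Term.eval] at hx
      rcases fm_eq _ _ _ _ (hx.trans (hX v).symm) with ⟨h1, h2, h⟩ | ⟨h1, h2, h3⟩
      · exact Or.inl h1
      · right
        have hs : (x.2.length : ZMod n) = (X v).2.length :=
          congrArg (fun s => s.1) (hc _ _ h1 h2 h3)
        rw [hs]
        rintro rfl
        exact hρ (Finset.mem_image_of_mem _ hv)
    | ind a =>
      have ha : a ∈ N := htN (by simp [Term.indNames])
      simp only [Term.eval, mkJ, ha, if_true] at hx
      exact Or.inl (fm_inl _ _ _ _ hx).1
  refine ⟨π', fun v => (GG I cl RN K n ρ (X v)).2, ?_⟩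
  intro at' hat
  have hs := hq at' hat
  have hv : at'.vars ⊆ qVars q := Finset.subset_biUnion_of_mem QAtom.vars hat
  have hi : at'.indNames ⊆ N := (Finset.subset_biUnion_of_mem QAtom.indNames hat).trans hqN
  cases at' with
  | ca A t =>
    obtain ⟨x, h1, h2, _⟩ := hs
    have hA := hqc A t hat
    simp only [QAtom.sat]
    rw [ev t hi x h1]
    have := congrFun (congrArg (fun l => l.1) (loc_GG I cl RN K n ρ x)) ⟨_, hA⟩
    simp only [loc, Concept.interp, eq_iff_iff] at this
    exact this.2 h2
  | ra r t t' =>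
    obtain ⟨x, y, h1, h2, h3, h4⟩ := hs
    have hr := hqr r t t' hat
    simp only [QAtom.vars] at hv
    simp only [QAtom.indNames] at hi
    have hit := Finset.union_subset_left hi
    have hit' := Finset.union_subset_right hi
    have hvt := Finset.union_subset_left hv
    have hvt' := Finset.union_subset_right hv
    simp only at h1 h2
    simp only [QAtom.sat]
    rw [ev t hit x h1, ev t' hit' y h2]
    rcases h4 with ⟨hx, hy⟩ | ⟨_, ⟨a, rfl⟩ | ⟨a, rfl⟩⟩
    · rw [GG_core _ _ _ _ _ _ hx, GG_core _ _ _ _ _ _ hy]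
      exact h3
    · obtain ⟨e1, e2⟩ := GG_edge I cl RN K n ρ x a (lev t' hvt' _ h2 hit')
      rw [e2]
      have := congrFun (congrFun (congrArg (fun l => l.2.1) e1) a) ⟨r, hr⟩
      simp only [loc, Prod.mk.injEq, eq_iff_iff] at this
      exact this.1.2 h3
    · obtain ⟨e1, e2⟩ := GG_edge I cl RN K n ρ y a (lev t hvt _ h1 hit)
      rw [e2]
      have := congrFun (congrFun (congrArg (fun l => l.2.1) e1) a) ⟨r, hr⟩
      simp only [loc, Prod.mk.injEq, eq_iff_iff] at this
      exact this.2.2 h3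

def Axiom.subs : Axiom → Finset Concept
  | Axiom.ci C D => C.subs ∪ D.subs
  | Axiom.ri _ _ => ∅

def QAtom.subs : QAtom → Finset Concept
  | QAtom.ca A _ => {Concept.atom A}
  | QAtom.ra _ _ _ => ∅

def clo (T : Finset Axiom) (q : BCQ) : Finset Concept :=
  T.biUnion Axiom.subs ∪ q.biUnion QAtom.subs

def rno (T : Finset Axiom) (q : BCQ) : Finset RName :=
  T.biUnion Axiom.rnames ∪ q.biUnion QAtom.rnames

theorem main_constr [Nonempty I.dom] (hP : I.Proper)
    (T V : Finset Axiom) (A : Finset Assertion) (q : BCQ) (hVT : V ⊆ T)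
    (code : Node I (clo T q) → ℕ)
    (hc : GoodCode I (clo T q) (rno T q) K code ((qVars q).card + 1))
    (hq : ¬ satQ I q)
    (hK0 : (⟨_, hP 0⟩ : I.dom) ∈ K)
    (hK : ∀ a ∈ kbInds T A ∪ qInds q, (⟨_, hP a⟩ : I.dom) ∈ K)
    (hKc : ∀ C D, Axiom.ci C D ∈ V → ∀ d : I.dom, d.1 ∈ vioCI I C D → d ∈ K)
    (hKr : ∀ r s, Axiom.ri r s ∈ V → ∀ d e : I.dom, (d.1, e.1) ∈ vioRI I r s → d ∈ K ∧ e ∈ K) :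
    ∃ J : Interp (U ⊕ ℕ), J.Proper ∧
      (∀ a ∈ kbInds T A ∪ qInds q, J.indI a = Sum.inl (I.indI a)) ∧
      ¬ satQ J q ∧
      (∀ α ∈ A, (Assertion.sat J α ↔ Assertion.sat I α)) ∧
      (∀ C D, Axiom.ci C D ∈ V → vioCI J C D ⊆ Sum.inl '' vioCI I C D) ∧
      (∀ r s, Axiom.ri r s ∈ V →
        vioRI J r s ⊆ (fun pr : U × U => ((Sum.inl pr.1 : U ⊕ ℕ), (Sum.inl pr.2 : U ⊕ ℕ))) ''
          vioRI I r s) ∧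
      J.dom ⊆ (fun d : I.dom => Sum.inl d.1) '' K ∪ Sum.inr '' Set.range code := by
  set N := kbInds T A ∪ qInds q with hN
  have fmK : ∀ d : I.dom, d ∈ K → fm I (clo T q) K code (d, []) = Sum.inl d.1 :=
    fun d hd => fm_core I (clo T q) K code (x := (d, [])) hd
  have hK' : ∀ a ∈ N, ∀ h : I.indI a ∈ I.dom, (⟨_, h⟩ : I.dom) ∈ K := fun a ha _ => hK a ha
  have hind : ∀ a ∈ N, (mkJ I (clo T q) (rno T q) K code N).indI a = Sum.inl (I.indI a) := by
    intro a ha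
    simp only [mkJ, ha, if_true]
  refine ⟨mkJ I (clo T q) (rno T q) K code N, ?_, hind, ?_, ?_, ?_, ?_, ?_⟩
  · intro a
    by_cases ha : a ∈ N
    · rw [hind a ha]
      exact ⟨_, fmK _ (hK a ha)⟩
    · simp only [mkJ, ha, if_false]
      exact ⟨_, fmK _ hK0⟩
  · intro h
    refine hq (no_query I (clo T q) (rno T q) K code N _ q rfl hc hK'
      Finset.subset_union_right ?_ ?_ h)
    · intro B t h
      refine Finset.mem_union_right _ (Finset.mem_biUnion.2 ⟨_, h, ?_⟩)
      simp [QAtom.subs]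
    · intro r t t' h
      refine Finset.mem_union_right _ (Finset.mem_biUnion.2 ⟨_, h, ?_⟩)
      simp [QAtom.rnames]
  · intro α hα
    have hαN : α.indNames ⊆ N := by
      refine (Finset.subset_biUnion_of_mem Assertion.indNames hα).trans ?_
      intro a ha
      exact Finset.mem_union_left _ (Finset.mem_union_right _ ha)
    cases α with
    | ca B a =>
      have ha : a ∈ N := hαN (by simp [Assertion.indNames])
      simp only [Assertion.sat]
      rw [hind a ha]
      constructor
      · rintro ⟨x, h1, h2, _⟩
        rw [(fm_inl _ _ _ _ h1).2] at h2
        exact h2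
      · intro h
        exact ⟨(⟨_, hP a⟩, []), fmK _ (hK a ha), h, Or.inl (hK a ha)⟩
    | ra r a b =>
      have ha : a ∈ N := hαN (by simp [Assertion.indNames])
      have hb : b ∈ N := hαN (by simp [Assertion.indNames])
      simp only [Assertion.sat]
      rw [hind a ha, hind b hb]
      constructor
      · rintro ⟨x, y, h1, h2, h3, _⟩
        rw [(fm_inl _ _ _ _ h1).2, (fm_inl _ _ _ _ h2).2] at h3
        exact h3
      · intro h
        exact ⟨(⟨_, hP a⟩, []), (⟨_, hP b⟩, []), fmK _ (hK a ha), fmK _ (hK b hb), h,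
          Or.inl ⟨hK a ha, hK b hb⟩⟩
  · intro C D hCD y hy
    have hT := hVT hCD
    have s1 : C.subs ∪ D.subs ⊆ clo T q :=
      (Finset.subset_biUnion_of_mem Axiom.subs hT).trans Finset.subset_union_left
    have s2 : C.rnames ∪ D.rnames ⊆ rno T q :=
      (Finset.subset_biUnion_of_mem Axiom.rnames hT).trans Finset.subset_union_left
    have s3 : C.indNames ∪ D.indNames ⊆ N :=
      (Finset.subset_biUnion_of_mem Axiom.indNames hT).trans
        (Finset.subset_union_left.trans Finset.subset_union_left)
    obtain ⟨x, rfl⟩ : y ∈ (mkJ I (clo T q) (rno T q) K code N).dom :=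
      Concept.interp_sub _ C hy.1
    have t1 := truth I (clo T q) (rno T q) K code N _ hc hK' C (Finset.union_subset_left s1)
      (Finset.union_subset_left s2) (Finset.union_subset_left s3) x
    have t2 := truth I (clo T q) (rno T q) K code N _ hc hK' D (Finset.union_subset_right s1)
      (Finset.union_subset_right s2) (Finset.union_subset_right s3) x
    have hv : (walk I (clo T q) x).1 ∈ vioCI I C D := ⟨t1.1 hy.1, fun h => hy.2 (t2.2 h)⟩
    exact ⟨_, hv, (fm_core _ _ _ _ (hKc C D hCD _ hv)).symm⟩
  · rintro r s hrs ⟨y1, y2⟩ hy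
    have hT := hVT hrs
    have s2 : {r.base, s.base} ⊆ rno T q :=
      (Finset.subset_biUnion_of_mem Axiom.rnames hT).trans Finset.subset_union_left
    obtain ⟨x, y, h1, h2, h3, h4⟩ := (role_mkJ ..).1 hy.1
    simp only at h1 h2
    subst h1 h2
    have hv : ((walk I (clo T q) x).1, (walk I (clo T q) y).1) ∈ vioRI I r s := by
      refine ⟨h3, fun h => hy.2 ((role_mkJ ..).2 ⟨x, y, rfl, rfl, h, ?_⟩)⟩
      rcases h4 with h4 | ⟨_, h4⟩
      · exact Or.inl h4
      · exact Or.inr ⟨s2 (by simp), h4⟩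
    obtain ⟨k1, k2⟩ := hKr r s hrs _ _ hv
    refine ⟨_, hv, ?_⟩
    simp only [fm_core _ _ _ _ k1, fm_core _ _ _ _ k2]
  · rintro _ ⟨x, rfl⟩
    by_cases hx : walk I (clo T q) x ∈ K
    · exact Or.inl ⟨_, hx, (fm_core _ _ _ _ hx).symm⟩
    · exact Or.inr ⟨_, ⟨x, rfl⟩, (fm_ncore _ _ _ _ hx).symm⟩

end Construction

theorem card_St (I : Interp U) (cl : Finset Concept) (RN : Finset RName) (K : Set I.dom)
    [Finite K] (n : ℕ) [NeZero n] [Finite (Wd cl n)] :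
    Nat.card (St I cl RN K n) = n * Nat.card (Wd cl n) *
      (((Nat.card (cl → Prop) * Nat.card (cl → RN → Prop × Prop)) * (K.ncard + 1)) ^
        Nat.card (Wd cl n)) ^ (n + 1) := by
  unfold St TP Loc
  rw [Nat.card_prod, Nat.card_prod, Nat.card_fun, Nat.card_fun, Nat.card_prod, Nat.card_prod,
    Finite.card_option, Nat.card_zmod, Nat.card_fin, Nat.card_coe_set_eq]
  ring

instance (cl : Finset Concept) (n : ℕ) : Finite (Wd cl n) := List.finite_length_le cl n

theorem finite_St (I : Interp U) (cl : Finset Concept) (RN : Finset RName) (K : Set I.dom)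
    [Finite K] (n : ℕ) [NeZero n] : Finite (St I cl RN K n) := by
  have : Finite (ZMod n) := Finite.of_fintype _
  have : Finite (Loc I cl RN K) := inferInstance
  have : Finite (TP I cl RN K n) := inferInstance
  have : Finite (Fin (n+1) → TP I cl RN K n) := inferInstance
  have : Finite (Wd cl n × (Fin (n+1) → TP I cl RN K n)) := inferInstance
  exact inferInstance

def coreL : U ⊕ U × U → U
  | Sum.inl u => u
  | Sum.inr p => p.1

def coreR : U ⊕ U × U → U
  | Sum.inl u => u
  | Sum.inr p => p.2

def coreU (I : Interp U) (N : Finset IndName) (V : Finset Axiom) : Set U :=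
  {I.indI 0} ∪ I.indI '' N ∪ (coreL '' vioSetV I V ∪ coreR '' vioSetV I V)

theorem card_aboxInds (A : Finset Assertion) : (aboxInds A).card ≤ aboxSize A := by
  refine Finset.card_biUnion_le.trans (Finset.sum_le_sum fun α _ => ?_)
  cases α with
  | ca B a => simp [Assertion.indNames, Assertion.size]
  | ra r a b => exact (Finset.card_le_two).trans (by simp [Assertion.size])

theorem card_coreU (I : Interp U) (T V : Finset Axiom) (A : Finset Assertion) (q : BCQ) :
    (coreU I (kbInds T A ∪ qInds q) V).encard ≤
      2 * ((aboxSize A : ℕ∞) + (vioSetV I V).encard) +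
        ((1 + (T.biUnion Axiom.indNames).card + (qInds q).card : ℕ) : ℕ∞) := by
  have h1 : (I.indI '' ((kbInds T A ∪ qInds q : Finset IndName) : Set IndName)).encard ≤
      (((T.biUnion Axiom.indNames).card + aboxSize A + (qInds q).card : ℕ) : ℕ∞) := by
    refine (Set.encard_image_le _ _).trans ?_
    rw [Set.encard_coe_eq_coe_finsetCard]
    norm_cast
    refine (Finset.card_union_le _ _).trans ?_
    have := Finset.card_union_le (T.biUnion Axiom.indNames) (aboxInds A)
    have := card_aboxInds A
    unfold kbInds
    omega
  calc (coreU I (kbInds T A ∪ qInds q) V).encard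
      ≤ (1 + (((T.biUnion Axiom.indNames).card + aboxSize A + (qInds q).card : ℕ) : ℕ∞)) +
        ((vioSetV I V).encard + (vioSetV I V).encard) := by
        refine (Set.encard_union_le _ _).trans (add_le_add ?_ ?_)
        · refine (Set.encard_union_le _ _).trans (add_le_add ?_ h1)
          simp
        · exact (Set.encard_union_le _ _).trans
            (add_le_add (Set.encard_image_le _ _) (Set.encard_image_le _ _))
    _ ≤ ((1 + (T.biUnion Axiom.indNames).card + (qInds q).card : ℕ) : ℕ∞) +
        (2 * (aboxSize A : ℕ∞) + 2 * (vioSetV I V).encard) := by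
        rw [two_mul (vioSetV I V).encard, ← add_assoc _ (2 * (aboxSize A : ℕ∞))]
        refine add_le_add ?_ le_rfl
        norm_cast
        omega
    _ = _ := by rw [mul_add, add_comm]

/-- For every `ALCHIO` TBox `T` and BCQ `q` there is a polynomial `p`
(with non-negative coefficients, independent of the ABox) such that for every ABox `A`,
every `V ⊆ T` and every interpretation `I ⊭ q`, there is an interpretation `J` (over the
universe extended with countably many fresh elements, interpreting the individual names
of the KB and the query as `I` does) with: (1) `J ⊭ q`; (2) `vio(A,J) = vio(A,I)`;
(3) `vio(τ,J) ⊆ vio(τ,I)` for every `τ ∈ V`; (4) `|Δ^J| ≤ p(|A| + |vio_V(I)|)`. -/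
theorem statement0 (T : Finset Axiom) (q : BCQ) :
    ∃ p : Polynomial ℕ,
      ∀ (A : Finset Assertion) (V : Finset Axiom), V ⊆ T →
        ∀ (U : Type) (I : Interp U), I.Proper → ¬ satQ I q →
          ∃ J : Interp (U ⊕ ℕ), J.Proper ∧
            (∀ a ∈ kbInds T A ∪ qInds q, J.indI a = Sum.inl (I.indI a)) ∧
            ¬ satQ J q ∧
            (∀ α ∈ A, (Assertion.sat J α ↔ Assertion.sat I α)) ∧
            (∀ C D, Axiom.ci C D ∈ V → vioCI J C D ⊆ Sum.inl '' vioCI I C D) ∧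
            (∀ r s, Axiom.ri r s ∈ V →
              vioRI J r s ⊆ (fun pr : U × U => ((Sum.inl pr.1 : U ⊕ ℕ), (Sum.inl pr.2 : U ⊕ ℕ))) ''
                vioRI I r s) ∧
            J.dom.encard ≤
              Polynomial.eval₂ (Nat.castRingHom ℕ∞)
                ((aboxSize A : ℕ∞) + (vioSetV I V).encard) p := by
  classical
  set n := (qVars q).card + 1 with hn
  have hnz : NeZero n := ⟨by omega⟩
  set c0 := 1 + (T.biUnion Axiom.indNames).card + (qInds q).card with hc0
  set w := Nat.card (Wd (clo T q) n) with hw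
  set c1 := Nat.card (clo T q → Prop) * Nat.card (clo T q → rno T q → Prop × Prop) with hc1
  refine ⟨(2 * Polynomial.X + Polynomial.C c0) +
    Polynomial.C (n * w) * ((Polynomial.C c1 * (2 * Polynomial.X + Polynomial.C c0 + 1)) ^ w) ^
      (n + 1), ?_⟩
  intro A V hVT U I hP hq
  have hne : Nonempty I.dom := ⟨⟨_, hP 0⟩⟩
  have memV : ∀ τ ∈ V, Axiom.vioSet I τ ⊆ vioSetV I V :=
    fun τ hτ => Set.subset_biUnion_of_mem (u := fun τ => Axiom.vioSet I τ) hτ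
  by_cases hfin : (vioSetV I V).Finite
  · set K : Set I.dom := Subtype.val ⁻¹' coreU I (kbInds T A ∪ qInds q) V with hKdef
    have hKle : K.encard ≤ 2 * ((aboxSize A : ℕ∞) + (vioSetV I V).encard) + (c0 : ℕ∞) := by
      refine le_trans ?_ (card_coreU I T V A q)
      rw [← Subtype.val_injective.encard_image K]
      exact Set.encard_le_encard (Set.image_preimage_subset _ _)
    obtain ⟨m, hm⟩ : ∃ m : ℕ, (vioSetV I V).encard = m :=
      ⟨_, hfin.encard_eq_coe⟩
    rw [hm] at hKle ⊢
    have hKfin : K.Finite := by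
      refine Set.finite_of_encard_le_coe (k := 2 * (aboxSize A + m) + c0) ?_
      exact_mod_cast hKle
    have hKF : Finite K := hKfin
    rw [← hKfin.cast_ncard_eq] at hKle
    have hKle' : K.ncard ≤ 2 * (aboxSize A + m) + c0 := by exact_mod_cast hKle
    have hSF := finite_St I (clo T q) (rno T q) K n
    have hSC : Countable (St I (clo T q) (rno T q) K n) := Finite.to_countable
    obtain ⟨enc, henc⟩ := Countable.exists_injective_nat (St I (clo T q) (rno T q) K n)
    obtain ⟨J, j1, j2, j3, j4, j5, j6, j7⟩ := main_constr I K hP T V A q hVT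
      (fun x => enc (st I (clo T q) (rno T q) K n x))
      (fun x y _ _ h => henc h) hq
      (Or.inl (Or.inl rfl))
      (fun a ha => Or.inl (Or.inr ⟨a, ha, rfl⟩))
      (fun C D h d hd => Or.inr (Or.inl ⟨Sum.inl d.1, memV _ h ⟨_, hd, rfl⟩, rfl⟩))
      (fun r s h d e hd => ⟨Or.inr (Or.inl ⟨_, memV _ h ⟨_, hd, rfl⟩, rfl⟩),
        Or.inr (Or.inr ⟨_, memV _ h ⟨_, hd, rfl⟩, rfl⟩)⟩)
    refine ⟨J, j1, j2, j3, j4, j5, j6, ?_⟩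
    have b1 : J.dom.encard ≤ ((K.ncard + Nat.card (St I (clo T q) (rno T q) K n) : ℕ) : ℕ∞) := by
      refine (Set.encard_le_encard j7).trans ((Set.encard_union_le _ _).trans ?_)
      push_cast
      refine add_le_add ((Set.encard_image_le _ _).trans hKfin.cast_ncard_eq.ge) ?_
      refine (Set.encard_image_le _ _).trans ?_
      have : Set.range (fun x => enc (st I (clo T q) (rno T q) K n x)) ⊆ enc '' Set.univ := by
        rintro _ ⟨x, rfl⟩
        exact ⟨_, trivial, rfl⟩
      refine (Set.encard_le_encard this).trans ((Set.encard_image_le _ _).trans ?_)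
      rw [Set.encard_univ, ENat.card_eq_coe_natCard]
    refine b1.trans ?_
    rw [card_St, ← hw, ← hc1]
    have b2 : K.ncard + n * w * ((c1 * (K.ncard + 1)) ^ w) ^ (n + 1) ≤
        (2 * (aboxSize A + m) + c0) +
          n * w * ((c1 * (2 * (aboxSize A + m) + c0 + 1)) ^ w) ^ (n + 1) := by
      gcongr
    refine (Nat.cast_le.2 b2).trans (le_of_eq ?_)
    simp [Polynomial.eval₂_add, Polynomial.eval₂_mul, Polynomial.eval₂_pow]
  · obtain ⟨J, j1, j2, j3, j4, j5, j6, j7⟩ := main_constr I Set.univ hP T V A q hVT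
      (fun x => 0) (fun x y h _ _ => absurd (Set.mem_univ _) h) hq
      (Set.mem_univ _) (fun a ha => Set.mem_univ _)
      (fun C D h d hd => Set.mem_univ _)
      (fun r s h d e hd => ⟨Set.mem_univ _, Set.mem_univ _⟩)
    refine ⟨J, j1, j2, j3, j4, j5, j6, ?_⟩
    rw [Set.Infinite.encard_eq hfin]
    simp [Polynomial.eval₂_add, Polynomial.eval₂_mul]

end DL
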